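/- For every k ≥ 1, every b ≥ 1 and every b-bounded coloring f : [ℕ]^k → ℕ, there exists an infinite set X ⊆ ℕ that is an f-rainbow. -/

import Mathlib

namespace RRT

/-- `n`-fold iterated "for almost all" along a nonprincipal ultrafilter. -/
def UP {C : Type} (g : Finset ℕ → C) (c : C) : ℕ → Finset ℕ → Prop
  | 0, s => g s = c
  | n + 1, s => ∀ᶠ x in (Filter.hyperfilter ℕ : Filter ℕ), UP g c n (insert x s)

theorem UP_exists {C : Type} [Finite C] (g : Finset ℕ → C) (n : ℕ) :
    ∀ s, ∃ c, UP g c n s := by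
  induction n with
  | zero => intro s; exact ⟨g s, rfl⟩
  | succ n ih =>
    intro s
    by_contra! h
    have h2 : ∀ c, ∀ᶠ x in (Filter.hyperfilter ℕ : Filter ℕ), ¬ UP g c n (insert x s) := by
      intro c
      exact Ultrafilter.eventually_not.2 (h c)
    obtain ⟨x, hx⟩ := (Filter.eventually_all.2 h2).exists
    obtain ⟨c, hc⟩ := ih (insert x s)
    exact hx c hc

def Good {C : Type} (g : Finset ℕ → C) (c : C) (k : ℕ) (F : Finset ℕ) : Prop :=
  ∀ s ⊆ F, s.card ≤ k → UP g c (k - s.card) s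

theorem Good_extend {C : Type} (g : Finset ℕ → C) (c : C) (k : ℕ) (F : Finset ℕ)
    (hF : Good g c k F) : ∃ x, x ∉ F ∧ Good g c k (insert x F) := by
  have h1 : ∀ᶠ x in (Filter.hyperfilter ℕ : Filter ℕ), x ∉ F :=
    (F.finite_toSet.compl_mem_hyperfilter : _)
  have h2 : ∀ᶠ x in (Filter.hyperfilter ℕ : Filter ℕ), ∀ s ∈ F.powerset, s.card < k →
      UP g c (k - s.card - 1) (insert x s) := by
    rw [Filter.eventually_all_finset]
    intro s hs
    by_cases hk : s.card < k
    · have := hF s (Finset.mem_powerset.1 hs) hk.le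
      obtain ⟨m, hm⟩ : ∃ m, k - s.card = m + 1 := ⟨k - s.card - 1, by omega⟩
      rw [hm] at this ⊢
      exact this.mono fun x hx _ => hx
    · exact Filter.Eventually.of_forall fun x h => absurd h hk
  obtain ⟨x, hx1, hx2⟩ := (h1.and h2).exists
  refine ⟨x, hx1, fun s hs hc => ?_⟩
  by_cases hxs : x ∈ s
  · have hsub : s.erase x ⊆ F := by
      intro y hy
      have := hs (Finset.mem_of_mem_erase hy)
      exact (Finset.mem_insert.1 this).resolve_left (Finset.ne_of_mem_erase hy)
    have hcard := Finset.card_erase_add_one hxs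
    have := hx2 (s.erase x) (Finset.mem_powerset.2 hsub) (by omega)
    rw [Finset.insert_erase hxs] at this
    have e : k - s.card = k - (s.erase x).card - 1 := by omega
    rw [e]; exact this
  · exact hF s ((Finset.subset_insert_iff_of_notMem hxs).1 hs) hc

/-- Infinite Ramsey theorem. -/
theorem ramsey {C : Type} [Finite C] (g : Finset ℕ → C) (k : ℕ) :
    ∃ X : Set ℕ, X.Infinite ∧ ∃ c, ∀ s : Finset ℕ, (s : Set ℕ) ⊆ X → s.card = k → g s = c := by
  obtain ⟨c, hc⟩ := UP_exists g k ∅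
  have h0 : Good g c k ∅ := by
    intro s hs _
    rw [Finset.subset_empty.1 hs]
    simpa using hc
  choose e he1 he2 using Good_extend g c k
  obtain ⟨G, hG0, hG⟩ : ∃ G : ℕ → {F : Finset ℕ // Good g c k F}, (G 0).1 = ∅ ∧
      ∀ n, (G (n+1)).1 = insert (e (G n).1 (G n).2) (G n).1 :=
    ⟨fun n => Nat.rec ⟨∅, h0⟩ (fun _ F => ⟨insert (e F.1 F.2) F.1, he2 F.1 F.2⟩) n,
      rfl, fun n => rfl⟩
  have hmono : Monotone fun n => (G n).1 := by
    refine monotone_nat_of_le_succ fun n => ?_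
    rw [hG]; exact Finset.subset_insert _ _
  have hcard : ∀ n, (G n).1.card = n := by
    intro n
    induction n with
    | zero => rw [hG0]; rfl
    | succ n ih => rw [hG, Finset.card_insert_of_notMem (he1 _ _), ih]
  refine ⟨⋃ n, ((G n).1 : Set ℕ), ?_, c, ?_⟩
  · intro hfin
    have hsub : ∀ n, (G n).1 ⊆ hfin.toFinset := by
      intro n x hx
      rw [Set.Finite.mem_toFinset]
      exact Set.mem_iUnion.2 ⟨n, hx⟩
    have := Finset.card_le_card (hsub (hfin.toFinset.card + 1))
    rw [hcard (hfin.toFinset.card + 1)] at this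
    omega
  · intro s hs hk
    have : ∃ n, s ⊆ (G n).1 := by
      choose! m hm using fun x (hx : x ∈ s) => Set.mem_iUnion.1 (hs hx)
      exact ⟨s.sup m, fun x hx => hmono (Finset.le_sup hx) (hm x hx)⟩
    obtain ⟨n, hn⟩ := this
    have := (G n).2 s hn hk.le
    rw [hk, Nat.sub_self] at this
    exact this

/-- Rainbow Ramsey Theorem RRT^k_b: for every `k ≥ 1`, `b ≥ 1` and every
`b`-bounded coloring `f` of the `k`-element subsets of ℕ (identified with strictly
increasing `k`-tuples), there is an infinite `f`-rainbow `X ⊆ ℕ`. -/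
theorem statement0 (k b : ℕ) (hk : 1 ≤ k) (hb : 1 ≤ b) (f : (Fin k → ℕ) → ℕ)
    (hbounded : ∀ c : ℕ, {s : Fin k → ℕ | StrictMono s ∧ f s = c}.encard ≤ (b : ℕ∞)) :
    ∃ X : Set ℕ, X.Infinite ∧
      ∀ s t : Fin k → ℕ, StrictMono s → StrictMono t →
        (∀ i, s i ∈ X) → (∀ i, t i ∈ X) → f s = f t → s = t := by
  haveI : Nonempty (Fin b) := ⟨⟨0, hb⟩⟩
  have h1 : ∀ c : ℕ, ∃ e : (Fin k → ℕ) → Fin b,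
      Set.InjOn e {s : Fin k → ℕ | StrictMono s ∧ f s = c} := by
    intro c
    have hfin : {s : Fin k → ℕ | StrictMono s ∧ f s = c}.Finite :=
      Set.finite_of_encard_le_coe (hbounded c)
    obtain ⟨e, _, he⟩ := hfin.exists_injOn_of_encard_le (t := (Set.univ : Set (Fin b)))
      (by simpa using hbounded c)
    exact ⟨e, he⟩
  choose e he using h1
  obtain ⟨X, hX, c, hc⟩ := ramsey (fun S : Finset ℕ =>
    if h : S.card = k then e (f (S.orderEmbOfFin h)) (S.orderEmbOfFin h) else ⟨0, hb⟩) k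
  have key : ∀ s : Fin k → ℕ, StrictMono s → (∀ i, s i ∈ X) → e (f s) s = c := by
    intro s hs hsX
    have hcard : (Finset.univ.image s).card = k := by
      rw [Finset.card_image_of_injective _ hs.injective]; simp
    have := hc (Finset.univ.image s) (by simpa [Set.range_subset_iff] using hsX) hcard
    have hu : s = (Finset.univ.image s).orderEmbOfFin hcard :=
      Finset.orderEmbOfFin_unique hcard (fun x => by simp) hs
    simp only [hcard, dif_pos] at this
    rw [← hu] at this
    exact this
  refine ⟨X, hX, fun s t hs ht hsX htX hst => ?_⟩
  refine he (f s) ⟨hs, rfl⟩ ⟨ht, hst.symm⟩ ?_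
  rw [key s hs hsX, hst, key t ht htX]

end RRT
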